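/- arXiv:1705.06685 — 2 statements merged into one kernel-verified Lean document; each statement's English description precedes it below -/
import Mathlib

section
/- Let k be an algebraically closed field of characteristic 0, A = k[x,y,z]/(x²+y²+z²−1), and let Ω = Ω_{A/k} be the A-module of Kähler differentials of A over k, with universal derivation d : A → Ω. Suppose L : Der_k(A) → End_k(Ω) is a map satisfying the Lie-derivative rule L(η)(a·d b) = η(a)·d b + a·d(η(b)) for all a, b ∈ A and η ∈ Der_k(A). If N ⊆ Ω is an A-submodule with L(η)(N) ⊆ N for all η ∈ Der_k(A), then N = 0 or N = Ω. That is, the module of 1-forms on the sphere is a simple AV-module. -/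
set_option synthInstance.maxHeartbeats 1000000
set_option maxHeartbeats 1000000

open MvPolynomial

noncomputable section

/-- The coordinate ring `A = k[x,y,z]/(x² + y² + z² - 1)` of the sphere `𝕊²`. -/
abbrev SphereRing (k : Type*) [Field k] := MvPolynomial (Fin 3) k ⧸
  Ideal.span {(X 0 ^ 2 + X 1 ^ 2 + X 2 ^ 2 - 1 : MvPolynomial (Fin 3) k)}

/-- The image of `x` in the coordinate ring of the sphere. -/
abbrev sx (k : Type*) [Field k] : SphereRing k := Ideal.Quotient.mk _ (X 0)

/-- The image of `y` in the coordinate ring of the sphere. -/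
abbrev sy (k : Type*) [Field k] : SphereRing k := Ideal.Quotient.mk _ (X 1)

/-- The image of `z` in the coordinate ring of the sphere. -/
abbrev sz (k : Type*) [Field k] : SphereRing k := Ideal.Quotient.mk _ (X 2)

/-- An ideal stable under `E` and `F` that contains a nonzero polynomial in `u` is everything. -/
theorem ideal_eq_top_of_aeval_mem {k R : Type*} [Field k] [CharZero k] [CommRing R] [Algebra k R]
    {u v z : R} (huv : u * v + z ^ 2 = 1) {E F : Derivation k R R}
    (hEu : E u = 0) (hEz : E z = u) (hFu : F u = -2 * z) {I : Ideal R}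
    (hE : ∀ a ∈ I, E a ∈ I) (hF : ∀ a ∈ I, F a ∈ I)
    (p : Polynomial k) (hp : p ≠ 0) (hpI : Polynomial.aeval u p ∈ I) : I = ⊤ := by
  induction hn : p.natDegree using Nat.strong_induction_on generalizing p with
  | _ n ih =>
  by_cases h0 : p.natDegree = 0
  · rw [Polynomial.eq_C_of_natDegree_eq_zero h0, Polynomial.aeval_C] at hpI
    refine I.eq_top_of_isUnit_mem hpI (IsUnit.map _ (isUnit_iff_ne_zero.mpr fun h => hp ?_))
    rw [Polynomial.eq_C_of_natDegree_eq_zero h0, h, map_zero]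
  · set q := Polynomial.aeval u (Polynomial.derivative p) with hq
    have h2q : -2 * z * q ∈ I := by
      have := hF _ hpI
      rwa [Derivation.map_aeval, hFu, smul_eq_mul, mul_comm] at this
    have hzq : z * q ∈ I := by
      have h := I.mul_mem_left (algebraMap k R (-(1 / 2))) h2q
      have h2 : algebraMap k R (-(1 / 2)) * -2 = 1 := by
        rw [show (-2 : R) = algebraMap k R (-2) by rw [map_neg, map_ofNat], ← map_mul]
        norm_num
      rwa [mul_assoc (-2), ← mul_assoc, h2, one_mul] at h
    have huq : u * q ∈ I := by
      have := hE _ hzq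
      simpa [hq, hEu, hEz, mul_comm] using this
    have hqI : q ∈ I := by
      have h := I.add_mem (I.mul_mem_left v huq) (I.mul_mem_left z hzq)
      rwa [show v * (u * q) + z * (z * q) = (u * v + z ^ 2) * q by ring, huv, one_mul] at h
    exact ih _ (hn ▸ Polynomial.natDegree_derivative_lt h0) _
      (Polynomial.derivative_ne_zero.mpr h0) hqI rfl

/-- If `E` kills `u` and `E z = u`, then `E` acts on polynomials in `u`, `z` as `u ∂/∂z`. -/
theorem derivation_eval₂_aeval {k R : Type*} [Field k] [CommRing R] [Algebra k R]
    {u z : R} {E : Derivation k R R} (hEu : E u = 0) (hEz : E z = u)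
    (P : Polynomial (Polynomial k)) :
    E (P.eval₂ (Polynomial.aeval u : Polynomial k →ₐ[k] R) z) =
      u * (Polynomial.derivative P).eval₂ (Polynomial.aeval u : Polynomial k →ₐ[k] R) z := by
  induction P using Polynomial.induction_on' with
  | add p q hp hq => simp [Polynomial.eval₂_add, hp, hq, mul_add]
  | monomial n a =>
    simp [Polynomial.eval₂_monomial, Polynomial.derivative_monomial, hEu, hEz,
      Derivation.leibniz_pow]
    ring

/-- An ideal stable under `E` and `F` that contains a nonzero polynomial in `u`, `z` contains a
nonzero polynomial in `u`, hence is everything. -/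
theorem ideal_eq_top_of_eval₂_mem {k R : Type*} [Field k] [CharZero k] [CommRing R] [Algebra k R]
    {u v z : R} (huv : u * v + z ^ 2 = 1) {E F : Derivation k R R}
    (hEu : E u = 0) (hEz : E z = u) (hFu : F u = -2 * z) {I : Ideal R}
    (hE : ∀ a ∈ I, E a ∈ I) (hF : ∀ a ∈ I, F a ∈ I)
    (P : Polynomial (Polynomial k)) (hP : P ≠ 0)
    (hPI : P.eval₂ (Polynomial.aeval u : Polynomial k →ₐ[k] R) z ∈ I) : I = ⊤ := by
  induction hn : P.natDegree using Nat.strong_induction_on generalizing P with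
  | _ n ih =>
  by_cases h0 : P.natDegree = 0
  · rw [Polynomial.eq_C_of_natDegree_eq_zero h0, Polynomial.eval₂_C] at hPI
    refine ideal_eq_top_of_aeval_mem huv hEu hEz hFu hE hF (P.coeff 0) (fun h => hP ?_) hPI
    rw [Polynomial.eq_C_of_natDegree_eq_zero h0, h, map_zero]
  · have hmem := hE _ hPI
    rw [derivation_eval₂_aeval hEu hEz] at hmem
    refine ih _ (lt_of_le_of_lt (Polynomial.natDegree_C_mul_le _ _)
      (hn ▸ Polynomial.natDegree_derivative_lt h0))
      (Polynomial.C Polynomial.X * Polynomial.derivative P)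
      (mul_ne_zero (Polynomial.C_ne_zero.mpr Polynomial.X_ne_zero)
        (Polynomial.derivative_ne_zero.mpr h0)) ?_ rfl
    simpa [Polynomial.eval₂_mul] using hmem

/-- Up to a power of `u`, every element of an algebra generated by `u`, `v`, `z` with
`u v + z² = 1` is a polynomial in `u`, `z`. -/
theorem exists_pow_mul_eq_eval₂ {k R : Type*} [Field k] [CommRing R] [Algebra k R]
    {u v z : R} (huv : u * v + z ^ 2 = 1) (hgen : Algebra.adjoin k {u, v, z} = ⊤) (a : R) :
    ∃ (m : ℕ) (P : Polynomial (Polynomial k)),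
      u ^ m * a = P.eval₂ (Polynomial.aeval u : Polynomial k →ₐ[k] R) z := by
  have ha : a ∈ Algebra.adjoin k {u, v, z} := hgen ▸ Algebra.mem_top
  induction ha using Algebra.adjoin_induction with
  | mem x hx =>
    rcases hx with rfl | rfl | rfl
    · exact ⟨0, Polynomial.C Polynomial.X, by simp⟩
    · refine ⟨1, 1 - Polynomial.X ^ 2, ?_⟩
      simp only [pow_one, Polynomial.eval₂_sub, Polynomial.eval₂_one, Polynomial.eval₂_X_pow]
      linear_combination huv
    · exact ⟨0, Polynomial.X, by simp⟩
  | algebraMap r => exact ⟨0, Polynomial.C (Polynomial.C r), by simp⟩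
  | add x y _ _ hx hy =>
    obtain ⟨m, P, hP⟩ := hx
    obtain ⟨n, Q, hQ⟩ := hy
    refine ⟨m + n, Polynomial.C (Polynomial.X ^ n) * P + Polynomial.C (Polynomial.X ^ m) * Q, ?_⟩
    simp only [Polynomial.eval₂_mul, Polynomial.eval₂_add, Polynomial.eval₂_C, ← hP, ← hQ,
      RingHom.coe_coe, map_pow (Polynomial.aeval u), Polynomial.aeval_X]
    ring
  | mul x y _ _ hx hy =>
    obtain ⟨m, P, hP⟩ := hx
    obtain ⟨n, Q, hQ⟩ := hy
    refine ⟨m + n, P * Q, ?_⟩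
    rw [Polynomial.eval₂_mul, ← hP, ← hQ]
    ring

/-- The sphere algebra in isotropic coordinates has no nontrivial ideal stable under the
derivations `E` and `F`. -/
theorem ideal_eq_top_of_derivation_stable {k R : Type*} [Field k] [CharZero k] [CommRing R]
    [Algebra k R] {u v z : R} (huv : u * v + z ^ 2 = 1)
    (hgen : Algebra.adjoin k {u, v, z} = ⊤) (hu : ∀ a, u * a = 0 → a = 0) {E F : Derivation k R R}
    (hEu : E u = 0) (hEz : E z = u) (hFu : F u = -2 * z) {I : Ideal R}
    (hE : ∀ a ∈ I, E a ∈ I) (hF : ∀ a ∈ I, F a ∈ I) {a : R} (ha : a ≠ 0) (haI : a ∈ I) :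
    I = ⊤ := by
  obtain ⟨m, P, hP⟩ := exists_pow_mul_eq_eval₂ huv hgen a
  refine ideal_eq_top_of_eval₂_mem huv hEu hEz hFu hE hF P ?_ (hP ▸ I.mul_mem_left _ haI)
  rintro rfl
  rw [Polynomial.eval₂_zero] at hP
  have key : ∀ n : ℕ, u ^ n * a ≠ 0 := by
    intro n
    induction n with
    | zero => simpa
    | succ n ih =>
      rw [pow_succ', mul_assoc]
      exact fun h => ih (hu _ h)
  exact key m hP

theorem sphere_relation (k : Type*) [Field k] : sx k ^ 2 + sy k ^ 2 + sz k ^ 2 = 1 := by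
  have h : (Ideal.Quotient.mk (Ideal.span
      {(X 0 ^ 2 + X 1 ^ 2 + X 2 ^ 2 - 1 : MvPolynomial (Fin 3) k)}))
      (X 0 ^ 2 + X 1 ^ 2 + X 2 ^ 2 - 1) = 0 :=
    Ideal.Quotient.eq_zero_iff_mem.mpr (Ideal.mem_span_singleton_self _)
  simp only [map_add, map_sub, map_pow, map_one] at h
  exact sub_eq_zero.mp h

theorem adjoin_sphere_coordinates (k : Type*) [Field k] :
    Algebra.adjoin k {sx k, sy k, sz k} = ⊤ := by
  refine eq_top_iff.mpr fun a _ => ?_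
  obtain ⟨p, rfl⟩ := Ideal.Quotient.mk_surjective a
  induction p using MvPolynomial.induction_on with
  | C r => exact Subalgebra.algebraMap_mem _ r
  | add p q hp hq => rw [map_add]; exact Subalgebra.add_mem _ (hp trivial) (hq trivial)
  | mul_X p i hp =>
    rw [map_mul]
    refine Subalgebra.mul_mem _ (hp trivial) (Algebra.subset_adjoin ?_)
    fin_cases i
    exacts [Or.inl rfl, Or.inr (Or.inl rfl), Or.inr (Or.inr rfl)]

/-- The infinitesimal rotation `r ↦ (c₀, c₁, c₂) × r` of the sphere. -/
theorem exists_rotation_derivation {k : Type*} [Field k] (c₀ c₁ c₂ : k) :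
    ∃ D : Derivation k (SphereRing k) (SphereRing k),
      D (sx k) = algebraMap k _ c₁ * sz k - algebraMap k _ c₂ * sy k ∧
      D (sy k) = algebraMap k _ c₂ * sx k - algebraMap k _ c₀ * sz k ∧
      D (sz k) = algebraMap k _ c₀ * sy k - algebraMap k _ c₁ * sx k := by
  let d : Derivation k (MvPolynomial (Fin 3) k) (MvPolynomial (Fin 3) k) :=
    mkDerivation k ![C c₁ * X 2 - C c₂ * X 1, C c₂ * X 0 - C c₀ * X 2,
      C c₀ * X 1 - C c₁ * X 0]
  have hd0 : d (X 0) = C c₁ * X 2 - C c₂ * X 1 := mkDerivation_X _ _ _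
  have hd1 : d (X 1) = C c₂ * X 0 - C c₀ * X 2 := mkDerivation_X _ _ _
  have hd2 : d (X 2) = C c₀ * X 1 - C c₁ * X 0 := mkDerivation_X _ _ _
  let f := Ideal.Quotient.mkₐ k (Ideal.span
    {(X 0 ^ 2 + X 1 ^ 2 + X 2 ^ 2 - 1 : MvPolynomial (Fin 3) k)})
  have hq : d (X 0 ^ 2 + X 1 ^ 2 + X 2 ^ 2 - 1) = 0 := by
    simp only [map_add, map_sub, Derivation.leibniz_pow, hd0, hd1, hd2, smul_eq_mul, nsmul_eq_mul,
      Derivation.map_one_eq_zero]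
    ring
  have hd : ∀ p, f p = 0 → f (d p) = 0 := by
    intro p hp
    obtain ⟨b, rfl⟩ := Ideal.mem_span_singleton'.mp (Ideal.Quotient.eq_zero_iff_mem.mp hp)
    rw [Derivation.leibniz, hq, smul_zero, zero_add, smul_eq_mul]
    exact Ideal.Quotient.eq_zero_iff_mem.mpr
      (Ideal.mul_mem_right _ _ (Ideal.mem_span_singleton_self _))
  have hs : Function.Surjective f := Ideal.Quotient.mkₐ_surjective _ _
  refine ⟨Derivation.liftOfSurjective hs hd, ?_, ?_, ?_⟩
  · refine (Derivation.liftOfSurjective_apply hs hd (X 0)).trans ?_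
    rw [hd0]; rfl
  · refine (Derivation.liftOfSurjective_apply hs hd (X 1)).trans ?_
    rw [hd1]; rfl
  · refine (Derivation.liftOfSurjective_apply hs hd (X 2)).trans ?_
    rw [hd2]; rfl

theorem prime_X_add_C_mul_X {k : Type*} [Field k] (i : k) :
    Prime (X 0 + C i * X 1 : MvPolynomial (Fin 3) k) := by
  let e : MvPolynomial (Fin 3) k ≃ₐ[k] MvPolynomial (Fin 3) k :=
    AlgEquiv.ofAlgHom (aeval ![X 0 + C i * X 1, X 1, X 2]) (aeval ![X 0 - C i * X 1, X 1, X 2])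
      (by ext j : 1; fin_cases j <;> simp [← algebraMap_eq])
      (by ext j : 1; fin_cases j <;> simp [← algebraMap_eq])
  have h : e (X 0) = X 0 + C i * X 1 := by simp [e]
  rw [← h]
  exact (MulEquiv.prime_iff e.toMulEquiv).mpr (MvPolynomial.X_prime)

theorem eq_zero_of_isotropic_mul_eq_zero {k : Type*} [Field k] (i : k) (a : SphereRing k)
    (ha : (sx k + algebraMap k _ i * sy k) * a = 0) : a = 0 := by
  obtain ⟨p, rfl⟩ := Ideal.Quotient.mk_surjective a
  have hmem : (X 0 + C i * X 1) * p ∈ Ideal.span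
      {(X 0 ^ 2 + X 1 ^ 2 + X 2 ^ 2 - 1 : MvPolynomial (Fin 3) k)} :=
    Ideal.Quotient.eq_zero_iff_mem.mp ha
  obtain ⟨b, hb⟩ := Ideal.mem_span_singleton'.mp hmem
  have hprime := prime_X_add_C_mul_X i
  have hdvd : (X 0 + C i * X 1 : MvPolynomial (Fin 3) k) ∣ b := by
    refine (hprime.dvd_or_dvd ⟨p, hb⟩).resolve_right ?_
    rintro ⟨r, hr⟩
    simpa using congrArg (MvPolynomial.eval (0 : Fin 3 → k)) hr
  obtain ⟨r, rfl⟩ := hdvd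
  refine Ideal.Quotient.eq_zero_iff_mem.mpr (Ideal.mem_span_singleton'.mpr ⟨r, ?_⟩)
  exact mul_left_cancel₀ hprime.ne_zero (by rw [← hb]; ring)

/-- The coordinate ring of the sphere has no nontrivial ideal stable under all derivations. -/
theorem sphere_ideal_eq_top_of_derivation_stable {k : Type*} [Field k] [IsAlgClosed k] [CharZero k]
    {I : Ideal (SphereRing k)}
    (hI : ∀ (η : Derivation k (SphereRing k) (SphereRing k)), ∀ a ∈ I, η a ∈ I)
    {a : SphereRing k} (ha : a ≠ 0) (haI : a ∈ I) : I = ⊤ := by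
  obtain ⟨i, hi⟩ := IsAlgClosed.exists_pow_nat_eq (-1 : k) (n := 2) (by norm_num)
  obtain ⟨E, hEx, hEy, hEz⟩ := exists_rotation_derivation i (-1) 0
  obtain ⟨F, hFx, hFy, -⟩ := exists_rotation_derivation (-i) (-1) 0
  have hi' : algebraMap k (SphereRing k) i ^ 2 = -1 := by rw [← map_pow, hi, map_neg, map_one]
  have hr := sphere_relation k
  have hneg (c : k) : algebraMap k (SphereRing k) (-c) = -algebraMap k (SphereRing k) c :=
    map_neg (algebraMap k (SphereRing k)) c
  simp only [hneg, map_one, map_zero, zero_mul, sub_zero, zero_sub] at hEx hEy hEz hFx hFy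
  refine ideal_eq_top_of_derivation_stable (u := sx k + algebraMap k _ i * sy k)
    (v := sx k - algebraMap k _ i * sy k) (z := sz k) (E := E) (F := F) ?_ ?_
    (eq_zero_of_isotropic_mul_eq_zero i) ?_ ?_ ?_ (hI E) (hI F) ha haI
  · linear_combination hr - sy k ^ 2 * hi'
  · rw [eq_top_iff, ← adjoin_sphere_coordinates k]
    set S := Algebra.adjoin k {sx k + algebraMap k _ i * sy k, sx k - algebraMap k _ i * sy k, sz k}
    have hu : sx k + algebraMap k _ i * sy k ∈ S := Algebra.subset_adjoin (by simp)
    have hv : sx k - algebraMap k _ i * sy k ∈ S := Algebra.subset_adjoin (by simp)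
    have hz : sz k ∈ S := Algebra.subset_adjoin (by simp)
    have h2 : algebraMap k (SphereRing k) (1 / 2) * 2 = 1 := by
      rw [show (2 : SphereRing k) = algebraMap k _ 2 from (map_ofNat _ 2).symm, ← map_mul]
      norm_num
    have hx : sx k ∈ S := by
      have h := S.mul_mem (S.algebraMap_mem (1 / 2)) (S.add_mem hu hv)
      convert h using 1
      linear_combination -sx k * h2
    have hy : sy k ∈ S := by
      have h := S.mul_mem (S.mul_mem (S.algebraMap_mem (1 / 2)) (S.algebraMap_mem i))
        (S.sub_mem hv hu)
      convert h using 1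
      linear_combination
        -sy k * h2 + 2 * algebraMap k (SphereRing k) (1 / 2) * sy k * hi'
    refine Algebra.adjoin_le ?_
    rintro _ (rfl | rfl | rfl)
    exacts [hx, hy, hz]
  · rw [map_add, Derivation.leibniz, Derivation.map_algebraMap, hEx, hEy, smul_eq_mul, smul_eq_mul]
    linear_combination -sz k * hi'
  · rw [hEz]; ring
  · rw [map_add, Derivation.leibniz, Derivation.map_algebraMap, hFx, hFy, smul_eq_mul, smul_eq_mul]
    linear_combination sz k * hi'

/-- On an algebra generated by `x`, `y`, `z` with `x² + y² + z² = 1`, a 1-form annihilated by the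
infinitesimal rotations about the coordinate axes vanishes. -/
theorem form_eq_zero_of_rotations {k R : Type*} [Field k] [CharZero k] [CommRing R] [Algebra k R]
    {x y z : R} (hr : x ^ 2 + y ^ 2 + z ^ 2 = 1) (hgen : Algebra.adjoin k {x, y, z} = ⊤)
    {D₁ D₂ D₃ : Derivation k R R}
    (h1x : D₁ x = 0) (h1y : D₁ y = -z) (h1z : D₁ z = y)
    (h2x : D₂ x = z) (h2y : D₂ y = 0) (h2z : D₂ z = -x)
    (h3x : D₃ x = -y) (h3y : D₃ y = x) (h3z : D₃ z = 0) {ω : Ω[R⁄k]}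
    (h1 : D₁.liftKaehlerDifferential ω = 0) (h2 : D₂.liftKaehlerDifferential ω = 0)
    (h3 : D₃.liftKaehlerDifferential ω = 0) : ω = 0 := by
  let d := KaehlerDifferential.D k R
  have hdr : x • d x + y • d y + z • d z = 0 := by
    have h1 := congrArg d hr
    simp only [map_add, Derivation.leibniz_pow, Derivation.map_one_eq_zero] at h1
    refine (smul_eq_zero.mp (?_ : (2 : k) • _ = _)).resolve_left two_ne_zero
    rw [← h1, ofNat_smul_eq_nsmul]
    simp only [Nat.add_one_sub_one, pow_one]
    module
  let T : Ω[R⁄k] →ₗ[R] Ω[R⁄k] :=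
    D₁.liftKaehlerDifferential.smulRight (y • d z - z • d y) +
      D₂.liftKaehlerDifferential.smulRight (z • d x - x • d z) +
      D₃.liftKaehlerDifferential.smulRight (x • d y - y • d x)
  have hT : T = LinearMap.id := by
    refine Derivation.liftKaehlerDifferential_unique _ _
      (Derivation.ext_of_adjoin_eq_top _ hgen ?_)
    have hTd (b : R) : T (d b) = D₁ b • (y • d z - z • d y) + D₂ b • (z • d x - x • d z) +
        D₃ b • (x • d y - y • d x) := by simp [T, d]
    have hx : T (d x) = d x := by
      rw [hTd, h1x, h2x, h3x]
      linear_combination (norm := module) (-x) • hdr + hr • d x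
    have hy : T (d y) = d y := by
      rw [hTd, h1y, h2y, h3y]
      linear_combination (norm := module) (-y) • hdr + hr • d y
    have hz : T (d z) = d z := by
      rw [hTd, h1z, h2z, h3z]
      linear_combination (norm := module) (-z) • hdr + hr • d z
    rintro _ (rfl | rfl | rfl)
    exacts [hx, hy, hz]
  simpa [T, h1, h2, h3] using (LinearMap.congr_fun hT ω).symm

/-- Derivations of the sphere separate 1-forms. -/
theorem sphere_form_eq_zero {k : Type*} [Field k] [CharZero k] (ω : Ω[SphereRing k⁄k])
    (h : ∀ η : Derivation k (SphereRing k) (SphereRing k), η.liftKaehlerDifferential ω = 0) :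
    ω = 0 := by
  obtain ⟨D₁, h1x, h1y, h1z⟩ := exists_rotation_derivation (1 : k) 0 0
  obtain ⟨D₂, h2x, h2y, h2z⟩ := exists_rotation_derivation (0 : k) 1 0
  obtain ⟨D₃, h3x, h3y, h3z⟩ := exists_rotation_derivation (0 : k) 0 1
  simp only [map_one, map_zero, zero_mul, one_mul, sub_zero, zero_sub, sub_self]
    at h1x h1y h1z h2x h2y h2z h3x h3y h3z
  exact form_eq_zero_of_rotations (sphere_relation k) (adjoin_sphere_coordinates k)
    h1x h1y h1z h2x h2y h2z h3x h3y h3z (h D₁) (h D₂) (h D₃)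

/-- A `k`-linear map satisfying the Lie derivative rule on the forms `a db` satisfies the Leibniz
rule for multiplication by functions. -/
theorem lieDerivative_smul {k R : Type*} [CommRing k] [CommRing R] [Algebra k R]
    (η : Derivation k R R) (l : Ω[R⁄k] →ₗ[k] Ω[R⁄k])
    (hl : ∀ a b : R, l (a • KaehlerDifferential.D k R b) =
      η a • KaehlerDifferential.D k R b + a • KaehlerDifferential.D k R (η b))
    (a : R) (ω : Ω[R⁄k]) : l (a • ω) = η a • ω + a • l ω := by
  have hω : ω ∈ Submodule.span R (Set.range (KaehlerDifferential.D k R)) := by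
    rw [KaehlerDifferential.span_range_derivation]; trivial
  induction hω using Submodule.span_induction generalizing a with
  | mem x hx =>
    obtain ⟨b, rfl⟩ := hx
    have h1 := hl 1 b
    simp only [one_smul, Derivation.map_one_eq_zero, zero_smul, zero_add] at h1
    rw [hl, h1]
  | zero => simp
  | add x y _ _ hx hy => simp only [smul_add, map_add, hx, hy]; abel
  | smul c x _ hx =>
    rw [smul_smul, hx, hx, Derivation.leibniz]
    simp only [smul_eq_mul, add_smul, smul_add, smul_smul]
    rw [mul_comm c (η a)]
    abel

/-- The defect of `A`-linearity of `η ↦ L η`. -/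
theorem lieDerivative_smul_derivation {k R : Type*} [CommRing k] [CommRing R] [Algebra k R]
    (η : Derivation k R R) (a : R) (l l' : Ω[R⁄k] →ₗ[k] Ω[R⁄k])
    (hl : ∀ b c : R, l (b • KaehlerDifferential.D k R c) =
      η b • KaehlerDifferential.D k R c + b • KaehlerDifferential.D k R (η c))
    (hl' : ∀ b c : R, l' (b • KaehlerDifferential.D k R c) =
      (a • η) b • KaehlerDifferential.D k R c + b • KaehlerDifferential.D k R ((a • η) c))
    (ω : Ω[R⁄k]) :
    l' ω = a • l ω + η.liftKaehlerDifferential ω • KaehlerDifferential.D k R a := by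
  have hω : ω ∈ Submodule.span R (Set.range (KaehlerDifferential.D k R)) := by
    rw [KaehlerDifferential.span_range_derivation]; trivial
  induction hω using Submodule.span_induction with
  | mem x hx =>
    obtain ⟨b, rfl⟩ := hx
    have h1 := hl 1 b
    have h2 := hl' 1 b
    simp only [one_smul, Derivation.map_one_eq_zero, zero_smul, zero_add] at h1 h2
    rw [h1, h2]
    simp
  | zero => simp
  | add x y _ _ hx hy => simp only [smul_add, map_add, add_smul, hx, hy]; abel
  | smul c x _ hx =>
    rw [lieDerivative_smul _ _ hl', lieDerivative_smul _ _ hl, hx]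
    simp only [map_smul, Derivation.smul_apply, smul_eq_mul, smul_add, smul_smul]
    rw [mul_comm c a]
    abel

/-- Simplicity of the module of 1-forms on the sphere as an `AV`-module: if
`L : Der_k(A) → End_k(Ω[A⁄k])` satisfies the Lie derivative rule
`L η (a • d b) = η a • d b + a • d (η b)`, then an `A`-submodule of `Ω[A⁄k]` invariant
under all `L η` is `0` or everything. -/
theorem sphere_one_forms_simple_AV_module
    (k : Type*) [Field k] [IsAlgClosed k] [CharZero k]
    (L : Derivation k (SphereRing k) (SphereRing k) →
      (Ω[SphereRing k⁄k] →ₗ[k] Ω[SphereRing k⁄k]))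
    (hL : ∀ (η : Derivation k (SphereRing k) (SphereRing k)) (a b : SphereRing k),
      L η (a • KaehlerDifferential.D k (SphereRing k) b) =
        η a • KaehlerDifferential.D k (SphereRing k) b +
          a • KaehlerDifferential.D k (SphereRing k) (η b))
    (N : Submodule (SphereRing k) (Ω[SphereRing k⁄k]))
    (hN : ∀ (η : Derivation k (SphereRing k) (SphereRing k)), ∀ ω ∈ N, L η ω ∈ N) :
    N = ⊥ ∨ N = ⊤ := by
  refine or_iff_not_imp_left.mpr fun hbot => ?_
  obtain ⟨ω, hω, hω0⟩ := N.ne_bot_iff.mp hbot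
  obtain ⟨η, hη⟩ : ∃ η : Derivation k (SphereRing k) (SphereRing k),
      η.liftKaehlerDifferential ω ≠ 0 := by
    by_contra! h
    exact hω0 (sphere_form_eq_zero ω h)
  have hmem : η.liftKaehlerDifferential ω ∈ N.colon Set.univ := by
    have hD : ∀ a, η.liftKaehlerDifferential ω • KaehlerDifferential.D k (SphereRing k) a ∈ N := by
      intro a
      have h := lieDerivative_smul_derivation η a (L η) (L (a • η)) (hL η) (hL (a • η)) ω
      rw [← sub_eq_iff_eq_add'.mpr h]
      exact N.sub_mem (hN _ ω hω) (N.smul_mem _ (hN _ ω hω))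
    refine Submodule.mem_colon.mpr fun τ _ => ?_
    have hτ : τ ∈ Submodule.span (SphereRing k)
        (Set.range (KaehlerDifferential.D k (SphereRing k))) := by
      rw [KaehlerDifferential.span_range_derivation]; trivial
    induction hτ using Submodule.span_induction with
    | mem x hx => obtain ⟨a, rfl⟩ := hx; exact hD a
    | zero => simp
    | add x y _ _ hx hy => rw [smul_add]; exact N.add_mem (hx trivial) (hy trivial)
    | smul c x _ hx => rw [smul_comm]; exact N.smul_mem _ (hx trivial)
  have htop : N.colon Set.univ = ⊤ := by
    refine sphere_ideal_eq_top_of_derivation_stable (fun μ a ha => ?_) hη hmem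
    refine Submodule.mem_colon.mpr fun τ _ => ?_
    have h := lieDerivative_smul μ (L μ) (hL μ) a τ
    rw [← sub_eq_iff_eq_add.mpr h]
    exact N.sub_mem (hN _ _ (Submodule.mem_colon.mp ha τ trivial))
      (Submodule.mem_colon.mp ha _ trivial)
  rw [eq_top_iff]
  intro τ _
  have h1 : (1 : SphereRing k) ∈ N.colon Set.univ := htop ▸ Submodule.mem_top
  simpa only [one_smul] using Submodule.mem_colon.mp h1 τ trivial

end
end

section
/- Let k be an algebraically closed field of characteristic 0, A = k[x,y,z]/(x²+y²+z²−1), A_z the localization of A at the powers of z with canonical map ι : A → A_z, D_x and D_y the unique k-derivations of A_z with D_x(x)=1, D_x(y)=0, D_y(x)=0, D_y(y)=1, and for η ∈ Der_k(A) let η̃ be the unique k-derivation of A_z with η̃(ι(a)) = ι(η(a)) for all a ∈ A. Fix α ∈ k and define for each η ∈ Der_k(A) the k-linear operator T_η on A_z by T_η(g) = η̃(g) + (α/2)·(D_x(η̃(x)) + D_y(η̃(y)))·g. If M ⊆ A_z is a nonzero A-submodule (A acting through ι) which is finitely generated as an A-module and satisfies T_η(M) ⊆ M for all η ∈ Der_k(A),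 then α = 2n·1_k for some integer n, i.e. α is an even integer. -/
set_option synthInstance.maxHeartbeats 1000000
set_option maxHeartbeats 1000000

open MvPolynomial

noncomputable section

theorem Polynomial.sq_ne_one_sub_X_sq {k : Type*} [Field k] [CharZero k] (p : Polynomial k) :
    p ^ 2 ≠ 1 - Polynomial.X ^ 2 := by
  intro h
  have h1 : p.eval 1 = 0 := by
    have := congrArg (Polynomial.eval 1) h
    simpa using this
  have h2 := congrArg (fun q => (Polynomial.derivative q).eval 1) h
  simp [Polynomial.derivative_pow, h1] at h2

namespace SphereRing

theorem prime_equation (k : Type*) [Field k] [CharZero k] :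
    Prime (X 0 ^ 2 + X 1 ^ 2 + X 2 ^ 2 - 1 : MvPolynomial (Fin 3) k) := by
  set c : MvPolynomial (Fin 2) k := X 0 ^ 2 + X 1 ^ 2 - 1 with hc
  have hmap : finSuccEquiv k 2 (X 0 ^ 2 + X 1 ^ 2 + X 2 ^ 2 - 1) =
      Polynomial.X ^ 2 + Polynomial.C c := by
    have e1 : finSuccEquiv k 2 (X 1) = Polynomial.C (X 0) := finSuccEquiv_X_succ (j := 0)
    have e2 : finSuccEquiv k 2 (X 2) = Polynomial.C (X 1) := finSuccEquiv_X_succ (j := 1)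
    simp only [map_sub, map_add, map_pow, map_one, finSuccEquiv_X_zero, e1, e2, hc]
    ring
  refine Irreducible.prime ?_
  rw [← MulEquiv.irreducible_iff (finSuccEquiv k 2), hmap]
  have hmonic : (Polynomial.X ^ 2 + Polynomial.C c).Monic :=
    Polynomial.monic_X_pow_add_C c two_ne_zero
  by_contra hirr
  obtain ⟨a, b, h0, h1⟩ := (hmonic.not_irreducible_iff_exists_add_mul_eq_coeff
    (Polynomial.natDegree_X_pow_add_C)).1 hirr
  simp [Polynomial.coeff_X_pow, Polynomial.coeff_C] at h0 h1
  have hsq : a ^ 2 = 1 - X 0 ^ 2 - X 1 ^ 2 := by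
    linear_combination -a * h1 + h0 - hc
  have h := congrArg (aeval (![Polynomial.X, 0] : Fin 2 → Polynomial k)) hsq
  simp only [map_pow, map_sub, map_one, aeval_X, Matrix.cons_val_zero, Matrix.cons_val_one] at h
  exact Polynomial.sq_ne_one_sub_X_sq _ (h.trans (by ring))

instance isDomain (k : Type*) [Field k] [CharZero k] : IsDomain (SphereRing k) := by
  have : (Ideal.span {(X 0 ^ 2 + X 1 ^ 2 + X 2 ^ 2 - 1 : MvPolynomial (Fin 3) k)}).IsPrime :=
    (Ideal.span_singleton_prime (prime_equation k).ne_zero).2 (prime_equation k)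
  exact Ideal.Quotient.isDomain _

variable {k : Type*} [Field k]

theorem equation : sx k ^ 2 + sy k ^ 2 + sz k ^ 2 = 1 := by
  have h : Ideal.Quotient.mk (Ideal.span {(X 0 ^ 2 + X 1 ^ 2 + X 2 ^ 2 - 1 :
      MvPolynomial (Fin 3) k)}) (X 0 ^ 2 + X 1 ^ 2 + X 2 ^ 2 - 1) = 0 :=
    Ideal.Quotient.eq_zero_iff_mem.2 (Ideal.mem_span_singleton_self _)
  simp only [map_sub, map_add, map_pow, map_one] at h
  exact sub_eq_zero.1 h

/-- Evaluation at a point of the sphere. -/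
def evalPoint (p : Fin 3 → k) (hp : p 0 ^ 2 + p 1 ^ 2 + p 2 ^ 2 = 1) : SphereRing k →+* k :=
  Ideal.Quotient.lift _ (MvPolynomial.eval p) fun a ha => by
    obtain ⟨b, rfl⟩ := Ideal.mem_span_singleton.1 ha
    simp [hp]

theorem sz_not_isUnit : ¬ IsUnit (sz k) := by
  intro h
  have := h.map (evalPoint ![1, 0, 0] (by simp))
  simp [evalPoint] at this

theorem sz_ne_zero : sz k ≠ 0 := by
  intro h
  have := congrArg (evalPoint ![0, 0, 1] (by simp)) h
  simp [evalPoint] at this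

/-- A vector field on affine space tangent to the sphere induces a derivation of the sphere. -/
theorem exists_derivation (v : Fin 3 → MvPolynomial (Fin 3) k)
    (hv : X 0 * v 0 + X 1 * v 1 + X 2 * v 2 = 0) :
    ∃ η : Derivation k (SphereRing k) (SphereRing k),
      ∀ i, η (Ideal.Quotient.mk _ (X i)) = Ideal.Quotient.mk _ (v i) := by
  set I := Ideal.span {(X 0 ^ 2 + X 1 ^ 2 + X 2 ^ 2 - 1 : MvPolynomial (Fin 3) k)}
  have hd : ∀ p, Ideal.Quotient.mkₐ k I p = 0 →
      Ideal.Quotient.mkₐ k I (mkDerivation k v p) = 0 := by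
    intro p hp
    obtain ⟨q, rfl⟩ := Ideal.mem_span_singleton.1 (Ideal.Quotient.eq_zero_iff_mem.1 hp)
    refine Ideal.Quotient.eq_zero_iff_mem.2 (Ideal.mem_span_singleton.2 ?_)
    refine ⟨mkDerivation k v q, ?_⟩
    simp only [Derivation.leibniz, Derivation.leibniz_pow, map_sub, map_add, mkDerivation_X,
      Derivation.map_one_eq_zero, smul_eq_mul, nsmul_eq_mul]
    push_cast
    linear_combination (2 * q) * hv
  refine ⟨Derivation.liftOfSurjective (Ideal.Quotient.mkₐ_surjective k I) hd, fun i => ?_⟩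
  have := Derivation.liftOfSurjective_apply (Ideal.Quotient.mkₐ_surjective k I) hd (X i)
  rw [mkDerivation_X] at this
  exact this

end SphereRing

theorem Derivation.apply_pow_mul_pow_of_mul_eq_one {k R : Type*} [CommRing k] [CommRing R]
    [Algebra k R] (D : Derivation k R R) {z w : R} (hzw : z * w = 1) (N n : ℕ) :
    D (z ^ N * w ^ n) = ((N : R) - n) * (w * D z) * (z ^ N * w ^ n) := by
  have hw : D w = -w ^ 2 * D z := D.leibniz_of_mul_eq_one ((mul_comm w z).trans hzw)
  have hz : ∀ N : ℕ, D (z ^ N) = N * (w * D z) * z ^ N := by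
    intro N
    induction N with
    | zero => simp
    | succ N ih =>
      rw [pow_succ, D.leibniz, ih]
      simp only [smul_eq_mul]
      push_cast
      linear_combination (-z ^ N * D z) * hzw
  have hwn : ∀ n : ℕ, D (w ^ n) = -n * (w * D z) * w ^ n := by
    intro n
    induction n with
    | zero => simp
    | succ n ih =>
      rw [pow_succ, D.leibniz, ih, hw]
      simp only [smul_eq_mul]
      push_cast
      ring
  rw [D.leibniz, hz, hwn]
  simp only [smul_eq_mul]
  ring

/-- A derivation preserving a subalgebra `B`, twisted by a logarithmic term with pole along `z`,
can preserve a set of elements made regular by `z ^ N / z ^ n` only if they stay regular after a further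
multiplication by the logarithmic derivative of `z`, unless the residues cancel. -/
theorem Subalgebra.mul_mem_of_twisted_derivation {k R : Type*} [Field k] [CommRing R]
    [Algebra k R] (B : Subalgebra k R) (D : Derivation k R R) (hD : ∀ b ∈ B, D b ∈ B)
    {z w : R} (hzw : z * w = 1) {N n : ℕ} {β : k} (hne : β - N + n ≠ 0) {M : Set R}
    (hM : ∀ m ∈ M, D m + β • (D z * w * m) ∈ M)
    (hB : ∀ m ∈ M, z ^ N * w ^ n * m ∈ B) {m : R} (hm : m ∈ M) :
    D z * w * (z ^ N * w ^ n * m) ∈ B := by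
  have h1 := hD _ (hB m hm)
  have h2 := hB _ (hM m hm)
  have h3 : (β - N + n) • (D z * w * (z ^ N * w ^ n * m)) ∈ B := by
    convert! B.sub_mem h2 h1 using 1
    rw [D.leibniz, D.apply_pow_mul_pow_of_mul_eq_one hzw]
    simp only [smul_eq_mul, Algebra.smul_def, map_add, map_sub, map_natCast]
    ring
  simpa [smul_smul, inv_mul_cancel₀ hne] using B.smul_mem h3 (β - N + n)⁻¹

/-- Rank-1 tensor modules on the sphere: if the localization `Az` of the coordinate ring of
the sphere away from `z`, with the twisted action
`T_η g = η̃ g + (α/2) (D_x(η̃ x) + D_y(η̃ y)) g` of the vector fields, contains a nonzero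
`A`-submodule which is finitely generated over `A` and invariant under all `T_η`, then `α`
is an even integer. -/
theorem sphere_rank_one_bounded_submodule_even
    (k : Type*) [Field k] [IsAlgClosed k] [CharZero k]
    (Az : Type*) [CommRing Az] [Algebra (SphereRing k) Az]
    [IsLocalization.Away (sz k) Az] [Algebra k Az] [IsScalarTower k (SphereRing k) Az]
    (Dx Dy : Derivation k Az Az)
    (hDxx : Dx (algebraMap (SphereRing k) Az (sx k)) = 1)
    (hDxy : Dx (algebraMap (SphereRing k) Az (sy k)) = 0)
    (hDyx : Dy (algebraMap (SphereRing k) Az (sx k)) = 0)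
    (hDyy : Dy (algebraMap (SphereRing k) Az (sy k)) = 1)
    (ext : Derivation k (SphereRing k) (SphereRing k) → Derivation k Az Az)
    (hext : ∀ (η : Derivation k (SphereRing k) (SphereRing k)) (a : SphereRing k),
      ext η (algebraMap (SphereRing k) Az a) = algebraMap (SphereRing k) Az (η a))
    (α : k)
    (M : Submodule (SphereRing k) Az)
    (hM0 : M ≠ ⊥)
    (hMfg : M.FG)
    (hMT : ∀ (η : Derivation k (SphereRing k) (SphereRing k)), ∀ g ∈ M,
      ext η g + (α / 2) •
        ((Dx (ext η (algebraMap (SphereRing k) Az (sx k))) +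
          Dy (ext η (algebraMap (SphereRing k) Az (sy k)))) * g) ∈ M) :
    ∃ n : ℤ, α = 2 * (n : k) := by
  set φ := algebraMap (SphereRing k) Az with hφ
  have hle : Submonoid.powers (sz k) ≤ nonZeroDivisors (SphereRing k) :=
    powers_le_nonZeroDivisors_of_noZeroDivisors SphereRing.sz_ne_zero
  have hinj : Function.Injective φ := IsLocalization.injective Az hle
  obtain ⟨w, hzw⟩ := (IsLocalization.Away.algebraMap_isUnit (S := Az) (sz k)).exists_right_inv
  have heq : φ (sx k) ^ 2 + φ (sy k) ^ 2 + φ (sz k) ^ 2 = 1 := by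
    simpa only [map_add, map_pow, map_one] using congrArg φ SphereRing.equation
  have hDz : ∀ D : Derivation k Az Az,
      φ (sx k) * D (φ (sx k)) + φ (sy k) * D (φ (sy k)) + φ (sz k) * D (φ (sz k)) = 0 := by
    intro D
    have h := congrArg D heq
    simp only [map_add, D.leibniz_pow, D.map_one_eq_zero, smul_eq_mul, nsmul_eq_mul] at h
    have h2 : algebraMap k Az (1 / 2) * 2 = 1 := by
      rw [← map_ofNat (algebraMap k Az) 2, ← map_mul]
      simp
    push_cast at h
    linear_combination algebraMap k Az (1 / 2) * h - (φ (sx k) * D (φ (sx k)) +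
      φ (sy k) * D (φ (sy k)) + φ (sz k) * D (φ (sz k))) * h2
  have hDxz : Dx (φ (sz k)) = -φ (sx k) * w := by
    have h := hDz Dx
    rw [hDxx, hDxy] at h
    linear_combination w * h - Dx (φ (sz k)) * hzw
  have hDyz : Dy (φ (sz k)) = -φ (sy k) * w := by
    have h := hDz Dy
    rw [hDyx, hDyy] at h
    linear_combination w * h - Dy (φ (sz k)) * hzw
  obtain ⟨η₁, h₁⟩ := SphereRing.exists_derivation (k := k) ![X 2, 0, -X 0] (by simp; ring)
  obtain ⟨η₂, h₂⟩ := SphereRing.exists_derivation (k := k) ![0, X 2, -X 1] (by simp; ring)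
  have h₁x : ext η₁ (φ (sx k)) = φ (sz k) := by rw [hext, h₁]; rfl
  have h₁y : ext η₁ (φ (sy k)) = 0 := by rw [hext, h₁]; simp
  have h₁z : ext η₁ (φ (sz k)) = -φ (sx k) := by rw [hext, h₁]; simp
  have h₂x : ext η₂ (φ (sx k)) = 0 := by rw [hext, h₂]; simp
  have h₂y : ext η₂ (φ (sy k)) = φ (sz k) := by rw [hext, h₂]; rfl
  have h₂z : ext η₂ (φ (sz k)) = -φ (sy k) := by rw [hext, h₂]; simp
  have hM₁ : ∀ m ∈ (M : Set Az),
      ext η₁ m + (α / 2) • (ext η₁ (φ (sz k)) * w * m) ∈ (M : Set Az) := by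
    intro m hm
    have h := hMT η₁ m hm
    rwa [h₁x, h₁y, map_zero, add_zero, hDxz, ← h₁z] at h
  have hM₂ : ∀ m ∈ (M : Set Az),
      ext η₂ m + (α / 2) • (ext η₂ (φ (sz k)) * w * m) ∈ (M : Set Az) := by
    intro m hm
    have h := hMT η₂ m hm
    rwa [h₂x, h₂y, map_zero, zero_add, hDyz, ← h₂z] at h
  let B : Subalgebra k Az := (IsScalarTower.toAlgHom k (SphereRing k) Az).range
  have hφB : ∀ a, φ a ∈ B := fun a => ⟨a, rfl⟩
  have hDB : ∀ η, ∀ b ∈ B, ext η b ∈ B := by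
    rintro η _ ⟨a, rfl⟩
    exact ⟨η a, (hext η a).symm⟩
  obtain ⟨N, hN⟩ : ∃ N : ℕ, ∀ m ∈ M, φ (sz k) ^ N * m ∈ B := by
    obtain ⟨s, rfl⟩ := hMfg
    obtain ⟨⟨_, N, rfl⟩, hb⟩ :=
      IsLocalization.exist_integer_multiples_of_finset (Submonoid.powers (sz k)) s
    refine ⟨N, fun m hm => ?_⟩
    induction hm using Submodule.span_induction with
    | mem m hm =>
      obtain ⟨a, ha⟩ := hb m hm
      refine ⟨a, ?_⟩
      simpa [Algebra.smul_def] using ha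
    | zero => simp
    | add m m' _ _ h h' => rw [mul_add]; exact B.add_mem h h'
    | smul a m _ h =>
      rw [Algebra.smul_def, mul_left_comm]
      exact B.mul_mem (hφB a) h
  by_contra! hα
  have hall : ∀ n : ℕ, ∀ m ∈ M, φ (sz k) ^ N * w ^ n * m ∈ B := by
    intro n
    induction n with
    | zero => simpa using hN
    | succ n ih =>
      intro m hm
      have hne : α / 2 - N + n ≠ 0 := by
        intro h
        refine hα ((N : ℤ) - n) ?_
        push_cast
        linear_combination 2 * h
      have hx := B.mul_mem_of_twisted_derivation (ext η₁) (hDB η₁) hzw hne hM₁ ih hm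
      have hy := B.mul_mem_of_twisted_derivation (ext η₂) (hDB η₂) hzw hne hM₂ ih hm
      rw [h₁z] at hx
      rw [h₂z] at hy
      convert! B.sub_mem (B.mul_mem (hφB (sz k)) (ih m hm))
        (B.add_mem (B.mul_mem (hφB (sx k)) hx) (B.mul_mem (hφB (sy k)) hy)) using 1
      linear_combination (-(φ (sz k) ^ N * w ^ n * m) * w) * heq +
        (φ (sz k) ^ N * w ^ n * m) * φ (sz k) * hzw
  refine hM0 ((Submodule.eq_bot_iff M).2 fun m hm => ?_)
  choose a ha using fun n => hall n m hm
  have ha' : ∀ n, φ (a n) = φ (sz k) ^ N * w ^ n * m := ha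
  have hzwn : ∀ n : ℕ, φ (sz k) ^ n * w ^ n = 1 := fun n => by rw [← mul_pow, hzw, one_pow]
  have h0 : a 0 ∈ ⨅ n : ℕ, Ideal.span {sz k} ^ n := by
    refine (Submodule.mem_iInf _).2 fun n => ?_
    rw [Ideal.span_singleton_pow]
    refine Ideal.mem_span_singleton.2 ⟨a n, hinj ?_⟩
    rw [map_mul, map_pow, ha', ha']
    linear_combination (-φ (sz k) ^ N * m) * hzwn n
  have h0' : a 0 = 0 := Ideal.mem_bot.1 ((Ideal.iInf_pow_eq_bot_of_isDomain _
    (mt Ideal.span_singleton_eq_top.1 SphereRing.sz_not_isUnit)).le h0)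
  have h := ha' 0
  rw [h0', map_zero] at h
  linear_combination (-w ^ N) * h - m * hzwn N

end
end
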